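/- arXiv:2008.12953 — 8 statements merged into one kernel-verified Lean document; each statement's English description precedes it below -/
import Mathlib

section
/- The function φ₃ : ℝ^N → ℝ is differentiable and its gradient at every w ∈ ℝ^N is ∇φ₃(w) = 3 Φ (w ⊗ w); that is, the Fréchet derivative of φ₃ at w is the linear map v ↦ 3 (Φ (w ⊗ w))ᵀ v. -/
open Matrix Finset Filter Topology

noncomputable section

/-- Kronecker product `w ⊗ w` of a vector with itself, viewed as a vector in `ℝ^{N²}`. -/
def kron2 {N : ℕ} (w : Fin N → ℝ) : Fin N × Fin N → ℝ := fun p => w p.1 * w p.2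

/-- Kronecker product `w ⊗ w ⊗ w`, viewed as a vector in `ℝ^{N³}`. -/
def kron3 {N : ℕ} (w : Fin N → ℝ) : Fin N × Fin N × Fin N → ℝ :=
  fun p => w p.1 * w p.2.1 * w p.2.2

/-- Sample covariance matrix `Σ = (1/T) ∑ₜ rₜ rₜᵀ`. -/
def covar {N T : ℕ} (r : Fin T → Fin N → ℝ) : Matrix (Fin N) (Fin N) ℝ :=
  (1 / (T : ℝ)) • ∑ t, vecMulVec (r t) (r t)

/-- Co-skewness matrix `Φ = (1/T) ∑ₜ rₜ (rₜᵀ ⊗ rₜᵀ) ∈ ℝ^{N×N²}`. -/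
def coskew {N T : ℕ} (r : Fin T → Fin N → ℝ) : Matrix (Fin N) (Fin N × Fin N) ℝ :=
  (1 / (T : ℝ)) • ∑ t, vecMulVec (r t) (kron2 (r t))

/-- Co-kurtosis matrix `Ψ = (1/T) ∑ₜ rₜ (rₜᵀ ⊗ rₜᵀ ⊗ rₜᵀ) ∈ ℝ^{N×N³}`. -/
def cokurt {N T : ℕ} (r : Fin T → Fin N → ℝ) : Matrix (Fin N) (Fin N × Fin N × Fin N) ℝ :=
  (1 / (T : ℝ)) • ∑ t, vecMulVec (r t) (kron3 (r t))

/-- Third sample central moment `φ₃(w) = (1/T) ∑ₜ (wᵀ rₜ)³`. -/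
def phi3 {N T : ℕ} (r : Fin T → Fin N → ℝ) (w : Fin N → ℝ) : ℝ :=
  (1 / (T : ℝ)) * ∑ t, (w ⬝ᵥ r t) ^ 3

/-- Fourth sample central moment `φ₄(w) = (1/T) ∑ₜ (wᵀ rₜ)⁴`. -/
def phi4 {N T : ℕ} (r : Fin T → Fin N → ℝ) (w : Fin N → ℝ) : ℝ :=
  (1 / (T : ℝ)) * ∑ t, (w ⬝ᵥ r t) ^ 4

/-- The ℓ₁ norm `‖w‖₁ = ∑ᵢ |wᵢ|`. -/
def ell1 {N : ℕ} (w : Fin N → ℝ) : ℝ := ∑ i, |w i|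

/-- The largest-`k` norm `‖w‖_[k]`: the maximum of `∑_{i ∈ S} |wᵢ|` over subsets `S` of
cardinality `k` (for `k ≤ N` the set below is a nonempty finite set of reals, so its
supremum is this maximum). -/
def topk {N : ℕ} (k : ℕ) (w : Fin N → ℝ) : ℝ :=
  sSup {x : ℝ | ∃ S : Finset (Fin N), S.card = k ∧ x = ∑ i ∈ S, |w i|}

/-- `s` is a subgradient of the largest-`k` norm at `w`. -/
def IsSubgradTopk {N : ℕ} (k : ℕ) (w s : Fin N → ℝ) : Prop :=
  ∀ v : Fin N → ℝ, topk k w + s ⬝ᵥ (v - w) ≤ topk k v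

/-- Feasible set `C = {w : 1ᵀ w = 1, |wᵢ| ≤ α ∀i}`. -/
def Feas (N : ℕ) (α : ℝ) : Set (Fin N → ℝ) :=
  {w | ∑ i, w i = 1 ∧ ∀ i, |w i| ≤ α}

/-- Maximum absolute row sum `max_{1≤i≤N} ∑ⱼ |A_{ij}|` (as the supremum of a nonempty
finite set of reals when `N ≥ 1`). -/
def maxRowSum {N : ℕ} {J : Type} [Fintype J] (A : Matrix (Fin N) J ℝ) : ℝ :=
  sSup (Set.range fun i : Fin N => ∑ j, |A i j|)

/-- The DC constant `τ_dc = 6αλ₃ max-row-sum(Φ) + 12α²λ₄ max-row-sum(Ψ)`. -/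
def tauDC {N T : ℕ} (α l3 l4 : ℝ) (r : Fin T → Fin N → ℝ) : ℝ :=
  6 * α * l3 * maxRowSum (coskew r) + 12 * α ^ 2 * l4 * maxRowSum (cokurt r)

/-- Convex part `f_cvx(w) = -λ₁ μᵀw + λ₂ wᵀ Σ w`. -/
def fcvx {N T : ℕ} (l1 l2 : ℝ) (μ : Fin N → ℝ) (r : Fin T → Fin N → ℝ) (w : Fin N → ℝ) : ℝ :=
  -l1 * (μ ⬝ᵥ w) + l2 * (w ⬝ᵥ (covar r).mulVec w)

/-- Non-convex part `f_ncvx(w) = -λ₃ wᵀ Φ (w⊗w) + λ₄ wᵀ Ψ (w⊗w⊗w)`. -/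
def fncvx {N T : ℕ} (l3 l4 : ℝ) (r : Fin T → Fin N → ℝ) (w : Fin N → ℝ) : ℝ :=
  -l3 * (w ⬝ᵥ (coskew r).mulVec (kron2 w)) + l4 * (w ⬝ᵥ (cokurt r).mulVec (kron3 w))

/-- Gradient of the non-convex part: `∇f_ncvx(w) = -3λ₃ Φ(w⊗w) + 4λ₄ Ψ(w⊗w⊗w)`. -/
def gradfncvx {N T : ℕ} (l3 l4 : ℝ) (r : Fin T → Fin N → ℝ) (w : Fin N → ℝ) : Fin N → ℝ :=
  (-(3 * l3)) • (coskew r).mulVec (kron2 w) + (4 * l4) • (cokurt r).mulVec (kron3 w)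

/-- Gradient of the MVSK objective `∇f = ∇f_cvx + ∇f_ncvx`. -/
def gradf {N T : ℕ} (l1 l2 l3 l4 : ℝ) (μ : Fin N → ℝ) (r : Fin T → Fin N → ℝ)
    (w : Fin N → ℝ) : Fin N → ℝ :=
  ((-l1) • μ + (2 * l2) • (covar r).mulVec w) + gradfncvx l3 l4 r w

/-- The MVSK objective `f = f_cvx + f_ncvx`. -/
def ftot {N T : ℕ} (l1 l2 l3 l4 : ℝ) (μ : Fin N → ℝ) (r : Fin T → Fin N → ℝ)
    (w : Fin N → ℝ) : ℝ :=
  fcvx l1 l2 μ r w + fncvx l3 l4 r w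

/-- The penalized objective `f_p(w) = f(w) + ρ (‖w‖₁ - ‖w‖_[k])`. -/
def fpen {N T : ℕ} (l1 l2 l3 l4 ρ : ℝ) (k : ℕ) (μ : Fin N → ℝ) (r : Fin T → Fin N → ℝ)
    (w : Fin N → ℝ) : ℝ :=
  ftot l1 l2 l3 l4 μ r w + ρ * (ell1 w - topk k w)

/-- The Kronecker product `I_N ⊗ w ∈ ℝ^{N²×N}` of the identity matrix with a (column) vector. -/
def kronIdVec {N : ℕ} (w : Fin N → ℝ) : Matrix (Fin N × Fin N) (Fin N) ℝ :=
  Matrix.of fun p j => (1 : Matrix (Fin N) (Fin N) ℝ) p.1 j * w p.2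

/-- The Kronecker product `I_N ⊗ w ⊗ w ∈ ℝ^{N³×N}`. -/
def kronIdVec2 {N : ℕ} (w : Fin N → ℝ) : Matrix (Fin N × Fin N × Fin N) (Fin N) ℝ :=
  Matrix.of fun p j => (1 : Matrix (Fin N) (Fin N) ℝ) p.1 j * w p.2.1 * w p.2.2

/-- The pDCA subproblem objective
`G(w) = f_cvx(w) + (τ_dc/2) wᵀw + ρ‖w‖₁ - (τ_dc wʲ - ∇f_ncvx(wʲ) + ρ sʲ)ᵀ w`. -/
def Gpdca {N T : ℕ} (l1 l2 l3 l4 α ρ : ℝ) (μ : Fin N → ℝ) (r : Fin T → Fin N → ℝ)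
    (wj sj w : Fin N → ℝ) : ℝ :=
  fcvx l1 l2 μ r w + tauDC α l3 l4 r / 2 * (w ⬝ᵥ w) + ρ * ell1 w
    - (tauDC α l3 l4 r • wj - gradfncvx l3 l4 r wj + ρ • sj) ⬝ᵥ w

end

theorem kron2_dotProduct_kron2 {N : ℕ} (u w : Fin N → ℝ) :
    kron2 u ⬝ᵥ kron2 w = (w ⬝ᵥ u) ^ 2 := by
  simp only [dotProduct, kron2, Fintype.sum_prod_type, sq, Finset.sum_mul_sum]
  exact Finset.sum_congr rfl fun i _ => Finset.sum_congr rfl fun j _ => by ring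

theorem coskew_mulVec_kron2 {N T : ℕ} (r : Fin T → Fin N → ℝ) (w : Fin N → ℝ) :
    (coskew r).mulVec (kron2 w) = (1 / (T : ℝ)) • ∑ t, (w ⬝ᵥ r t) ^ 2 • r t := by
  simp only [coskew, smul_mulVec, sum_mulVec, vecMulVec_mulVec, kron2_dotProduct_kron2,
    op_smul_eq_smul]

theorem hasFDerivAt_dotProduct_left {N : ℕ} (u w : Fin N → ℝ) :
    HasFDerivAt (fun x : Fin N → ℝ => x ⬝ᵥ u)
      (∑ i, u i • ContinuousLinearMap.proj (R := ℝ) (φ := fun _ : Fin N => ℝ) i) w := by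
  simp only [dotProduct]
  exact HasFDerivAt.fun_sum fun i _ => (hasFDerivAt_apply i w).mul_const (u i)

theorem hasFDerivAt_phi3 {N T : ℕ} (r : Fin T → Fin N → ℝ) (w : Fin N → ℝ) :
    HasFDerivAt (phi3 r)
      ((1 / (T : ℝ)) • ∑ t, (3 * (w ⬝ᵥ r t) ^ 2) •
        ∑ i, r t i • ContinuousLinearMap.proj (R := ℝ) (φ := fun _ : Fin N => ℝ) i) w := by
  refine HasFDerivAt.const_mul (HasFDerivAt.fun_sum fun t _ => ?_) _
  simpa using (hasFDerivAt_dotProduct_left (r t) w).pow 3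

/-- `φ₃` is differentiable with gradient `∇φ₃(w) = 3 Φ (w ⊗ w)`, i.e. its
Fréchet derivative at `w` is the linear map `v ↦ 3 (Φ (w ⊗ w))ᵀ v`. -/
theorem phi3_gradient {N T : ℕ} (hT : 1 ≤ T) (r : Fin T → Fin N → ℝ) :
    Differentiable ℝ (phi3 r) ∧
      ∀ (w v : Fin N → ℝ),
        fderiv ℝ (phi3 r) w v = ((3 : ℝ) • (coskew r).mulVec (kron2 w)) ⬝ᵥ v := by
  refine ⟨fun w => (hasFDerivAt_phi3 r w).differentiableAt, fun w v => ?_⟩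
  rw [(hasFDerivAt_phi3 r w).fderiv, coskew_mulVec_kron2]
  simp only [smul_dotProduct, sum_dotProduct, _root_.smul_apply, _root_.sum_apply,
    ContinuousLinearMap.proj_apply, smul_eq_mul]
  rw [mul_left_comm (3 : ℝ), Finset.mul_sum _ _ (3 : ℝ)]
  simp only [mul_assoc, dotProduct]
end

section
/- The function φ₄ : ℝ^N → ℝ is twice differentiable and its Hessian at every w ∈ ℝ^N is the matrix ∇²φ₄(w) = 12 Ψ (I_N ⊗ w ⊗ w), where I_N is the N×N identity matrix; that is, the second Fréchet derivative of φ₄ at w applied to (u, v) equals uᵀ (12 Ψ (I_N ⊗ w ⊗ w)) v. -/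
open Matrix Finset Filter Topology

/-- The continuous linear functional `w ↦ wᵀ a`. -/
def dotProductRightCLM {N : ℕ} (a : Fin N → ℝ) : (Fin N → ℝ) →L[ℝ] ℝ :=
  ∑ i, a i • ContinuousLinearMap.proj (R := ℝ) (φ := fun _ : Fin N => ℝ) i

lemma dotProductRightCLM_apply {N : ℕ} (a w : Fin N → ℝ) :
    dotProductRightCLM a w = w ⬝ᵥ a := by
  simp [dotProductRightCLM, dotProduct, mul_comm]

lemma hasFDerivAt_dotProduct_pow {N : ℕ} (a w : Fin N → ℝ) (n : ℕ) :
    HasFDerivAt (fun x => (x ⬝ᵥ a) ^ n)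
      ((n * (w ⬝ᵥ a) ^ (n - 1)) • dotProductRightCLM a) w := by
  have h := (dotProductRightCLM a).hasFDerivAt (x := w)
  simpa [dotProductRightCLM_apply] using h.pow n

lemma hasFDerivAt_phi4 {N T : ℕ} (r : Fin T → Fin N → ℝ) (w : Fin N → ℝ) :
    HasFDerivAt (phi4 r)
      ((1 / (T : ℝ)) • ∑ t, (4 * (w ⬝ᵥ r t) ^ 3) • dotProductRightCLM (r t)) w :=
  (HasFDerivAt.fun_sum fun t _ => by
    simpa using hasFDerivAt_dotProduct_pow (r t) w 4).const_mul _

lemma hasFDerivAt_fderiv_phi4 {N T : ℕ} (r : Fin T → Fin N → ℝ) (w : Fin N → ℝ) :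
    HasFDerivAt (fun x => fderiv ℝ (phi4 r) x)
      ((1 / (T : ℝ)) • ∑ t, ((12 * (w ⬝ᵥ r t) ^ 2) • dotProductRightCLM (r t)).smulRight
        (dotProductRightCLM (r t))) w := by
  simp only [fun x => (hasFDerivAt_phi4 r x).fderiv]
  refine HasFDerivAt.fun_const_smul (HasFDerivAt.fun_sum fun t _ =>
    HasFDerivAt.smul_const ?_ _) _
  convert (hasFDerivAt_dotProduct_pow (r t) w 3).const_mul 4 using 1
  rw [smul_smul]
  norm_num [← mul_assoc]

lemma kron3_vecMul_kronIdVec2 {N : ℕ} (a w : Fin N → ℝ) :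
    kron3 a ᵥ* kronIdVec2 w = (w ⬝ᵥ a) ^ 2 • a := by
  ext j
  simp only [vecMul, dotProduct, kron3, kronIdVec2, Matrix.of_apply, Fintype.sum_prod_type,
    Matrix.one_apply, Pi.smul_apply, smul_eq_mul, pow_two, Finset.sum_mul_sum]
  rw [Finset.sum_eq_single j (fun i _ hi => by simp [hi]) (by simp)]
  simp only [if_true, Finset.sum_mul]
  exact Finset.sum_congr rfl fun _ _ => Finset.sum_congr rfl fun _ _ => by ring

lemma cokurt_mul_kronIdVec2 {N T : ℕ} (r : Fin T → Fin N → ℝ) (w : Fin N → ℝ) :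
    cokurt r * kronIdVec2 w =
      (1 / (T : ℝ)) • ∑ t, (w ⬝ᵥ r t) ^ 2 • vecMulVec (r t) (r t) := by
  simp only [cokurt, Matrix.smul_mul, Matrix.sum_mul, vecMulVec_mul, kron3_vecMul_kronIdVec2,
    vecMulVec_smul]

/-- `φ₄` is twice differentiable with Hessian `∇²φ₄(w) = 12 Ψ (I_N ⊗ w ⊗ w)`:
the second Fréchet derivative at `w` applied to `(u, v)` equals
`uᵀ (12 Ψ (I_N ⊗ w ⊗ w)) v`. -/
theorem phi4_hessian {N T : ℕ} (hT : 1 ≤ T) (r : Fin T → Fin N → ℝ) :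
    Differentiable ℝ (phi4 r) ∧
      Differentiable ℝ (fun x => fderiv ℝ (phi4 r) x) ∧
      ∀ (w u v : Fin N → ℝ),
        fderiv ℝ (fun x => fderiv ℝ (phi4 r) x) w u v =
          u ⬝ᵥ ((12 : ℝ) • (cokurt r * kronIdVec2 w)).mulVec v := by
  refine ⟨fun w => (hasFDerivAt_phi4 r w).differentiableAt,
    fun w => (hasFDerivAt_fderiv_phi4 r w).differentiableAt, fun w u v => ?_⟩
  rw [(hasFDerivAt_fderiv_phi4 r w).fderiv, cokurt_mul_kronIdVec2]
  simp only [_root_.smul_apply, _root_.sum_apply,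
    ContinuousLinearMap.smulRight_apply, dotProductRightCLM_apply, smul_mulVec, sum_mulVec,
    vecMulVec_mulVec, dotProduct_smul, dotProduct_sum, smul_eq_mul, op_smul_eq_smul]
  rw [mul_left_comm]
  congr 1
  rw [Finset.mul_sum]
  refine Finset.sum_congr rfl fun t _ => ?_
  rw [dotProduct_comm (r t) v]
  ring
end

section
/- For every w ∈ ℝ^N with |w_i| ≤ α for all i, the spectral radius of the Hessian matrix M(w) = −6 λ₃ Φ (I_N ⊗ w) + 12 λ₄ Ψ (I_N ⊗ w ⊗ w) of f_ncvx at w satisfies ρ(M(w)) ≤ 6 α λ₃ · max_{1≤i≤N} Σ_{j=1}^{N²} |Φ_{ij}| + 12 α² λ₄ · max_{1≤i≤N} Σ_{j=1}^{N³} |Ψ_{ij}|. -/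
open Matrix Finset Filter Topology

attribute [local instance] Matrix.linftyOpNormedRing Matrix.linftyOpNormedAlgebra in
theorem spectralRadius_map_ofReal_le_of_row_sum_le {n : Type*} [Fintype n] [DecidableEq n]
    [Nonempty n] (A : Matrix n n ℝ) (b : ℝ) (h : ∀ i, ∑ j, |A i j| ≤ b) :
    spectralRadius ℂ (A.map Complex.ofReal) ≤ ENNReal.ofReal b := by
  refine (spectrum.spectralRadius_le_nnnorm (𝕜 := ℂ) (A.map Complex.ofReal)).trans ?_
  rw [ENNReal.ofReal, ENNReal.coe_le_coe, Matrix.linfty_opNNNorm_def]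
  refine Finset.sup_le fun i _ => NNReal.le_toNNReal_of_coe_le ?_
  simpa using h i

theorem row_sum_le_maxRowSum {N : ℕ} {J : Type} [Fintype J] (A : Matrix (Fin N) J ℝ) (i : Fin N) :
    ∑ j, |A i j| ≤ maxRowSum A :=
  le_csSup (Set.finite_range _).bddAbove ⟨i, rfl⟩

theorem sum_abs_mul_apply_le {m J n : Type*} [Fintype J] [Fintype n]
    (A : Matrix m J ℝ) (B : Matrix J n ℝ) (c : ℝ) (hB : ∀ p, ∑ j, |B p j| ≤ c) (i : m) :
    ∑ j, |(A * B) i j| ≤ c * ∑ p, |A i p| := by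
  calc ∑ j, |(A * B) i j| ≤ ∑ j, ∑ p, |A i p| * |B p j| := by
        refine Finset.sum_le_sum fun j _ => ?_
        simpa only [Matrix.mul_apply, abs_mul] using
          Finset.abs_sum_le_sum_abs (fun p => A i p * B p j) Finset.univ
    _ = ∑ p, |A i p| * ∑ j, |B p j| := by
        rw [Finset.sum_comm]
        simp only [Finset.mul_sum]
    _ ≤ ∑ p, |A i p| * c :=
        Finset.sum_le_sum fun p _ => mul_le_mul_of_nonneg_left (hB p) (abs_nonneg _)
    _ = c * ∑ p, |A i p| := by rw [← Finset.sum_mul, mul_comm]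

theorem sum_abs_kronIdVec {N : ℕ} (w : Fin N → ℝ) (p : Fin N × Fin N) :
    ∑ j, |kronIdVec w p j| = |w p.2| := by
  simp [kronIdVec, Matrix.one_apply, apply_ite abs]

theorem sum_abs_kronIdVec2 {N : ℕ} (w : Fin N → ℝ) (p : Fin N × Fin N × Fin N) :
    ∑ j, |kronIdVec2 w p j| = |w p.2.1| * |w p.2.2| := by
  simp [kronIdVec2, Matrix.one_apply, abs_mul, apply_ite abs]

/-- spectral radius bound on the Hessian
`M(w) = −6λ₃ Φ (I⊗w) + 12λ₄ Ψ (I⊗w⊗w)` of `f_ncvx`, for `w` in the box `|wᵢ| ≤ α`: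
`ρ(M(w)) ≤ 6αλ₃ maxᵢ ∑ⱼ |Φᵢⱼ| + 12α²λ₄ maxᵢ ∑ⱼ |Ψᵢⱼ|`. -/
theorem hessian_spectral_radius_bound {N T : ℕ} (hN : 0 < N) (hT : 1 ≤ T)
    (l3 l4 α : ℝ) (hl3 : 0 < l3) (hl4 : 0 < l4) (hα : 0 < α)
    (r : Fin T → Fin N → ℝ) (w : Fin N → ℝ) (hw : ∀ i, |w i| ≤ α) :
    spectralRadius ℂ
        (((-(6 * l3)) • (coskew r * kronIdVec w)
            + (12 * l4) • (cokurt r * kronIdVec2 w)).map Complex.ofReal)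
      ≤ ENNReal.ofReal
          (6 * α * l3 * maxRowSum (coskew r) + 12 * α ^ 2 * l4 * maxRowSum (cokurt r)) := by
  have : Nonempty (Fin N) := ⟨⟨0, hN⟩⟩
  refine spectralRadius_map_ofReal_le_of_row_sum_le _ _ fun i => ?_
  have hΦ : ∑ j, |(coskew r * kronIdVec w) i j| ≤ α * maxRowSum (coskew r) :=
    (sum_abs_mul_apply_le _ _ α (fun p => (sum_abs_kronIdVec w p).trans_le (hw _)) i).trans
      (mul_le_mul_of_nonneg_left (row_sum_le_maxRowSum _ i) hα.le)
  have hΨ : ∑ j, |(cokurt r * kronIdVec2 w) i j| ≤ α ^ 2 * maxRowSum (cokurt r) := by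
    refine (sum_abs_mul_apply_le _ _ (α ^ 2) (fun p => ?_) i).trans
      (mul_le_mul_of_nonneg_left (row_sum_le_maxRowSum _ i) (by positivity))
    rw [sum_abs_kronIdVec2, sq]
    exact mul_le_mul (hw _) (hw _) (abs_nonneg _) hα.le
  calc ∑ j, |((-(6 * l3)) • (coskew r * kronIdVec w)
          + (12 * l4) • (cokurt r * kronIdVec2 w)) i j|
      ≤ ∑ j, (6 * l3 * |(coskew r * kronIdVec w) i j|
          + 12 * l4 * |(cokurt r * kronIdVec2 w) i j|) := by
        refine Finset.sum_le_sum fun j _ => ?_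
        rw [Matrix.add_apply, Matrix.smul_apply, Matrix.smul_apply, smul_eq_mul, smul_eq_mul]
        refine (abs_add_le _ _).trans_eq ?_
        rw [abs_mul, abs_mul, abs_neg, abs_of_pos (by positivity : 0 < 6 * l3),
          abs_of_pos (by positivity : 0 < 12 * l4)]
    _ = 6 * l3 * ∑ j, |(coskew r * kronIdVec w) i j|
          + 12 * l4 * ∑ j, |(cokurt r * kronIdVec2 w) i j| := by
        rw [Finset.sum_add_distrib, Finset.mul_sum, Finset.mul_sum]
    _ ≤ 6 * l3 * (α * maxRowSum (coskew r)) + 12 * l4 * (α ^ 2 * maxRowSum (cokurt r)) := by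
        gcongr
    _ = 6 * α * l3 * maxRowSum (coskew r) + 12 * α ^ 2 * l4 * maxRowSum (cokurt r) := by ring
end

section
/- For every w ∈ ℝ^N and every integer k with 1 ≤ k ≤ N, the cardinality constraint ‖w‖₀ ≤ k holds if and only if ‖w‖₁ − ‖w‖_[k] = 0. -/
open Matrix Finset Filter Topology

/-- For `k ≤ N` the supremum defining the largest-`k` norm is attained. -/
lemma topk_isGreatest {N k : ℕ} (hkN : k ≤ N) (w : Fin N → ℝ) :
    IsGreatest {x : ℝ | ∃ S : Finset (Fin N), S.card = k ∧ x = ∑ i ∈ S, |w i|} (topk k w) := by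
  have hne : {x : ℝ | ∃ S : Finset (Fin N), S.card = k ∧ x = ∑ i ∈ S, |w i|}.Nonempty := by
    obtain ⟨S, -, hS⟩ := Finset.exists_subset_card_eq (s := (Finset.univ : Finset (Fin N)))
      (n := k) (by simpa using hkN)
    exact ⟨_, S, hS, rfl⟩
  have hfin : {x : ℝ | ∃ S : Finset (Fin N), S.card = k ∧ x = ∑ i ∈ S, |w i|}.Finite :=
    (Set.finite_range fun S : Finset (Fin N) => ∑ i ∈ S, |w i|).subset
      fun _ ⟨S, _, hx⟩ => ⟨S, hx.symm⟩
  exact ⟨hne.csSup_mem hfin, fun _ hx => le_csSup hfin.bddAbove hx⟩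

/-- A partial sum of the `|wᵢ|` is all of `‖w‖₁` iff its index set contains the support of `w`. -/
lemma sum_abs_eq_ell1_iff {N : ℕ} (w : Fin N → ℝ) (S : Finset (Fin N)) :
    ∑ i ∈ S, |w i| = ell1 w ↔ {i | w i ≠ 0} ⊆ (S : Set (Fin N)) := by
  have hsplit := Finset.sum_add_sum_compl S fun i => |w i|
  have hzero := Finset.sum_eq_zero_iff_of_nonneg (s := Sᶜ) fun i _ => abs_nonneg (w i)
  have hiff : ∑ i ∈ S, |w i| = ell1 w ↔ ∑ i ∈ Sᶜ, |w i| = 0 := by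
    unfold ell1
    constructor <;> intro h <;> linarith
  rw [hiff, hzero]
  simp only [Finset.mem_compl, abs_eq_zero, Set.subset_def, Set.mem_ofPred_eq, Finset.mem_coe]
  exact forall_congr' fun i => not_imp_comm

/-- Every partial sum of the `|wᵢ|` is at most `‖w‖₁`. -/
lemma sum_abs_le_ell1 {N : ℕ} (w : Fin N → ℝ) (S : Finset (Fin N)) :
    ∑ i ∈ S, |w i| ≤ ell1 w :=
  Finset.sum_le_univ_sum_of_nonneg fun i => abs_nonneg (w i)

/-- DC representation of the cardinality constraint:
`‖w‖₀ ≤ k ↔ ‖w‖₁ − ‖w‖_[k] = 0`. -/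
theorem card_constraint_dc {N : ℕ} (k : ℕ) (hk1 : 1 ≤ k) (hkN : k ≤ N)
    (w : Fin N → ℝ) :
    Nat.card {i : Fin N // w i ≠ 0} ≤ k ↔ ell1 w - topk k w = 0 := by
  obtain ⟨⟨S, hScard, hS⟩, hub⟩ := topk_isGreatest hkN w
  have hcard : Nat.card {i : Fin N // w i ≠ 0} = (Finset.univ.filter fun i => w i ≠ 0).card := by
    rw [Nat.card_eq_fintype_card, Fintype.card_subtype]
  rw [hcard, sub_eq_zero]
  constructor
  · intro h
    obtain ⟨R, hsub, hR⟩ := Finset.exists_superset_card_eq h (by simpa using hkN)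
    have hRsum : ∑ i ∈ R, |w i| = ell1 w :=
      (sum_abs_eq_ell1_iff w R).2 fun i hi => hsub (by simpa using hi)
    exact le_antisymm (hub ⟨R, hR, hRsum.symm⟩) (hS ▸ sum_abs_le_ell1 w S)
  · intro h
    have hsub := (sum_abs_eq_ell1_iff w S).1 (hS.symm.trans h.symm)
    rw [← hScard]
    exact Finset.card_le_card fun i hi => hsub (by simpa using hi)
end

section
/- Suppose w^j ∈ C, s^j is a subgradient of the largest-k norm at w^j, and w^{j+1} minimizes over C the pDCA subproblem objective G_j(w) = f_cvx(w) + (τ_dc/2) wᵀw + ρ‖w‖₁ − (τ_dc w^j − ∇f_ncvx(w^j) + ρ s^j)ᵀ w. Then f_p(w^{j+1}) ≤ f_p(w^j) − (τ_dc/2) ‖w^{j+1} − w^j‖². -/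
open Matrix Finset Filter Topology

theorem abs_quadratic_le_maxRowSum {N : ℕ} {K : Type} [Fintype K]
    (A : Matrix (Fin N) (Fin N × K) ℝ) (hA : ∀ i j k, A i (j, k) = A j (i, k))
    (d : Fin N → ℝ) (v : K → ℝ) (c : ℝ) (hc : 0 ≤ c) (hv : ∀ k, |v k| ≤ c) :
    |d ⬝ᵥ A.mulVec (fun p => d p.1 * v p.2)| ≤ c * maxRowSum A * ∑ i, d i ^ 2 := by
  have hterm : ∀ i j k, |d i * (A i (j, k) * (d j * v k))|
      ≤ c / 2 * (|A i (j, k)| * d i ^ 2) + c / 2 * (|A j (i, k)| * d j ^ 2) := by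
    intro i j k
    rw [← hA i j k]
    have h1 : |d i| * |d j| ≤ (d i ^ 2 + d j ^ 2) / 2 := by
      nlinarith [sq_nonneg (|d i| - |d j|), sq_abs (d i), sq_abs (d j)]
    calc |d i * (A i (j, k) * (d j * v k))|
        = |A i (j, k)| * ((|d i| * |d j|) * |v k|) := by simp only [abs_mul]; ring
      _ ≤ |A i (j, k)| * ((d i ^ 2 + d j ^ 2) / 2 * c) := by
          gcongr
          exact hv k
      _ = _ := by ring
  have hsum : ∑ i, ∑ j, ∑ k, |A i (j, k)| * d i ^ 2 ≤ maxRowSum A * ∑ i, d i ^ 2 := by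
    rw [Finset.mul_sum]
    refine Finset.sum_le_sum fun i _ => ?_
    simp only [← Finset.sum_mul]
    rw [← Fintype.sum_prod_type (fun p : Fin N × K => |A i p|)]
    exact mul_le_mul_of_nonneg_right (row_sum_le_maxRowSum A i) (sq_nonneg _)
  calc |d ⬝ᵥ A.mulVec (fun p => d p.1 * v p.2)|
      = |∑ i, ∑ j, ∑ k, d i * (A i (j, k) * (d j * v k))| := by
        simp only [dotProduct, mulVec, Fintype.sum_prod_type, Finset.mul_sum]
    _ ≤ ∑ i, ∑ j, ∑ k, |d i * (A i (j, k) * (d j * v k))| := by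
        refine (Finset.abs_sum_le_sum_abs _ _).trans (Finset.sum_le_sum fun i _ => ?_)
        refine (Finset.abs_sum_le_sum_abs _ _).trans (Finset.sum_le_sum fun j _ => ?_)
        exact Finset.abs_sum_le_sum_abs _ _
    _ ≤ ∑ i, ∑ j, ∑ k,
          (c / 2 * (|A i (j, k)| * d i ^ 2) + c / 2 * (|A j (i, k)| * d j ^ 2)) := by
        gcongr with i _ j _ k _
        exact hterm i j k
    _ = c * ∑ i, ∑ j, ∑ k, |A i (j, k)| * d i ^ 2 := by
        simp only [Finset.sum_add_distrib, ← Finset.mul_sum]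
        rw [Finset.sum_comm (f := fun i j => ∑ k, |A j (i, k)| * d j ^ 2)]
        ring
    _ ≤ c * (maxRowSum A * ∑ i, d i ^ 2) := by gcongr
    _ = _ := by ring

theorem dotProduct_average_vecMulVec_mulVec {N T : ℕ} {J : Type} [Fintype J]
    (r : Fin T → Fin N → ℝ) (q : Fin T → J → ℝ) (u : Fin N → ℝ) (x : J → ℝ) :
    u ⬝ᵥ ((1 / (T : ℝ)) • ∑ t, vecMulVec (r t) (q t)).mulVec x
      = (1 / (T : ℝ)) * ∑ t, (u ⬝ᵥ r t) * (q t ⬝ᵥ x) := by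
  rw [smul_mulVec, dotProduct_smul, Matrix.sum_mulVec, dotProduct_sum, smul_eq_mul]
  congr 1
  refine Finset.sum_congr rfl fun t _ => ?_
  rw [vecMulVec_mulVec]
  simp [dotProduct_smul, mul_comm]

theorem kron2_dotProduct {N : ℕ} (a x y : Fin N → ℝ) :
    kron2 a ⬝ᵥ (fun p => x p.1 * y p.2) = (x ⬝ᵥ a) * (y ⬝ᵥ a) := by
  simp only [kron2, dotProduct, Fintype.sum_prod_type, Finset.sum_mul_sum]
  exact Finset.sum_congr rfl fun i _ => Finset.sum_congr rfl fun j _ => by ring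

theorem kron3_dotProduct {N : ℕ} (a x y z : Fin N → ℝ) :
    kron3 a ⬝ᵥ (fun p => x p.1 * (y p.2.1 * z p.2.2))
      = (x ⬝ᵥ a) * ((y ⬝ᵥ a) * (z ⬝ᵥ a)) := by
  rw [← kron2_dotProduct a y z]
  simp only [kron3, kron2, dotProduct, Fintype.sum_prod_type, Finset.sum_mul]
  simp only [Finset.mul_sum]
  exact Finset.sum_congr rfl fun i _ => Finset.sum_congr rfl fun j _ =>
    Finset.sum_congr rfl fun k _ => by ring

theorem coskew_form {N T : ℕ} (r : Fin T → Fin N → ℝ) (u x y : Fin N → ℝ) :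
    u ⬝ᵥ (coskew r).mulVec (fun p => x p.1 * y p.2)
      = (1 / (T : ℝ)) * ∑ t, (u ⬝ᵥ r t) * ((x ⬝ᵥ r t) * (y ⬝ᵥ r t)) := by
  simp only [coskew, dotProduct_average_vecMulVec_mulVec, kron2_dotProduct]

theorem cokurt_form {N T : ℕ} (r : Fin T → Fin N → ℝ) (u x y z : Fin N → ℝ) :
    u ⬝ᵥ (cokurt r).mulVec (fun p => x p.1 * (y p.2.1 * z p.2.2))
      = (1 / (T : ℝ)) * ∑ t, (u ⬝ᵥ r t) * ((x ⬝ᵥ r t) * ((y ⬝ᵥ r t) * (z ⬝ᵥ r t))) := by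
  simp only [cokurt, dotProduct_average_vecMulVec_mulVec, kron3_dotProduct]

theorem coskew_symm {N T : ℕ} (r : Fin T → Fin N → ℝ) (i j k : Fin N) :
    coskew r i (j, k) = coskew r j (i, k) := by
  simp only [coskew, Matrix.smul_apply, Matrix.sum_apply, vecMulVec_apply, kron2]
  congr 1
  exact Finset.sum_congr rfl fun t _ => by ring

theorem cokurt_symm {N T : ℕ} (r : Fin T → Fin N → ℝ) (i j : Fin N) (k : Fin N × Fin N) :
    cokurt r i (j, k) = cokurt r j (i, k) := by
  simp only [cokurt, Matrix.smul_apply, Matrix.sum_apply, vecMulVec_apply, kron3]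
  congr 1
  exact Finset.sum_congr rfl fun t _ => by ring

theorem coskew_taylor {N T : ℕ} (r : Fin T → Fin N → ℝ) (x y : Fin N → ℝ) :
    y ⬝ᵥ (coskew r).mulVec (kron2 y) - x ⬝ᵥ (coskew r).mulVec (kron2 x)
        - 3 * ((y - x) ⬝ᵥ (coskew r).mulVec (kron2 x))
      = (y - x) ⬝ᵥ (coskew r).mulVec (fun p => (y - x) p.1 * (y + (2 : ℝ) • x) p.2) := by
  unfold kron2
  simp only [coskew_form, sub_dotProduct, add_dotProduct, smul_dotProduct, smul_eq_mul,
    Finset.mul_sum, ← Finset.sum_sub_distrib]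
  exact Finset.sum_congr rfl fun t _ => by ring

theorem cokurt_taylor {N T : ℕ} (r : Fin T → Fin N → ℝ) (x y : Fin N → ℝ) :
    y ⬝ᵥ (cokurt r).mulVec (kron3 y) - x ⬝ᵥ (cokurt r).mulVec (kron3 x)
        - 4 * ((y - x) ⬝ᵥ (cokurt r).mulVec (kron3 x))
      = (y - x) ⬝ᵥ (cokurt r).mulVec (fun p => (y - x) p.1 *
          (y p.2.1 * y p.2.2 + 2 * (y p.2.1 * x p.2.2) + 3 * (x p.2.1 * x p.2.2))) := by
  have h : (fun p : Fin N × Fin N × Fin N => (y - x) p.1 *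
        (y p.2.1 * y p.2.2 + 2 * (y p.2.1 * x p.2.2) + 3 * (x p.2.1 * x p.2.2)))
      = (fun p => (y - x) p.1 * (y p.2.1 * y p.2.2))
        + (2 : ℝ) • (fun p => (y - x) p.1 * (y p.2.1 * x p.2.2))
        + (3 : ℝ) • (fun p => (y - x) p.1 * (x p.2.1 * x p.2.2)) := by
    funext p
    simp only [Pi.add_apply, Pi.smul_apply, smul_eq_mul]
    ring
  have hk : ∀ w : Fin N → ℝ, kron3 w = fun p => w p.1 * (w p.2.1 * w p.2.2) := fun w => by
    funext p
    simp only [kron3, mul_assoc]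
  rw [h, hk, hk]
  simp only [mulVec_add, mulVec_smul, dotProduct_add, dotProduct_smul, cokurt_form,
    sub_dotProduct, smul_eq_mul, Finset.mul_sum, ← Finset.sum_sub_distrib,
    ← Finset.sum_add_distrib]
  exact Finset.sum_congr rfl fun t _ => by ring

/-- Descent inequality for the non-convex part on the box `|wᵢ| ≤ α`. -/
theorem fncvx_descent {N T : ℕ} (l3 l4 α : ℝ) (hl3 : 0 ≤ l3) (hl4 : 0 ≤ l4) (hα : 0 ≤ α)
    (r : Fin T → Fin N → ℝ) (x y : Fin N → ℝ) (hx : ∀ i, |x i| ≤ α) (hy : ∀ i, |y i| ≤ α) :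
    fncvx l3 l4 r y ≤ fncvx l3 l4 r x + gradfncvx l3 l4 r x ⬝ᵥ (y - x)
      + tauDC α l3 l4 r / 2 * ∑ i, (y i - x i) ^ 2 := by
  have hmul : ∀ {a b : ℝ}, |a| ≤ α → |b| ≤ α → |a * b| ≤ α ^ 2 := fun {a b} ha hb => by
    rw [abs_mul, sq]
    exact mul_le_mul ha hb (abs_nonneg _) hα
  have h3 := abs_quadratic_le_maxRowSum (coskew r) (coskew_symm r) (y - x) (y + (2 : ℝ) • x)
    (3 * α) (by positivity) (fun k => by
      have h1 := abs_le.1 (hx k)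
      have h2 := abs_le.1 (hy k)
      simp only [Pi.add_apply, Pi.smul_apply, smul_eq_mul]
      exact abs_le.2 ⟨by linarith, by linarith⟩)
  have h4 := abs_quadratic_le_maxRowSum (cokurt r) (cokurt_symm r) (y - x)
    (fun p => y p.1 * y p.2 + 2 * (y p.1 * x p.2) + 3 * (x p.1 * x p.2))
    (6 * α ^ 2) (by positivity) (fun k => by
      have h1 := abs_le.1 (hmul (hy k.1) (hy k.2))
      have h2 := abs_le.1 (hmul (hy k.1) (hx k.2))
      have h3 := abs_le.1 (hmul (hx k.1) (hx k.2))
      exact abs_le.2 ⟨by linarith, by linarith⟩)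
  rw [← coskew_taylor] at h3
  rw [← cokurt_taylor] at h4
  have h3' := mul_le_mul_of_nonneg_left (abs_le.1 h3).1 hl3
  have h4' := mul_le_mul_of_nonneg_left (abs_le.1 h4).2 hl4
  simp only [Pi.sub_apply] at h3' h4'
  have hg : gradfncvx l3 l4 r x ⬝ᵥ (y - x)
      = -(3 * l3) * ((y - x) ⬝ᵥ (coskew r).mulVec (kron2 x))
        + 4 * l4 * ((y - x) ⬝ᵥ (cokurt r).mulVec (kron3 x)) := by
    rw [dotProduct_comm, gradfncvx, dotProduct_add, dotProduct_smul, dotProduct_smul,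
      smul_eq_mul, smul_eq_mul]
  rw [hg]
  unfold fncvx tauDC
  linarith

theorem convexOn_dotProduct {N : ℕ} (a : Fin N → ℝ) (s : Set (Fin N → ℝ)) (hs : Convex ℝ s) :
    ConvexOn ℝ s (fun w => a ⬝ᵥ w) :=
  ⟨hs, fun x _ y _ p q _ _ _ => by simp [dotProduct_add, dotProduct_smul]⟩

theorem convexOn_ell1 {N : ℕ} (s : Set (Fin N → ℝ)) (hs : Convex ℝ s) :
    ConvexOn ℝ s (ell1 (N := N)) := by
  refine ⟨hs, fun x _ y _ p q hp hq _ => ?_⟩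
  simp only [ell1, smul_eq_mul, Finset.mul_sum, ← Finset.sum_add_distrib]
  refine Finset.sum_le_sum fun i _ => (abs_add_le _ _).trans_eq ?_
  simp [abs_mul, abs_of_nonneg hp, abs_of_nonneg hq]

theorem convexOn_fcvx {N T : ℕ} (l1 l2 : ℝ) (hl2 : 0 ≤ l2) (μ : Fin N → ℝ)
    (r : Fin T → Fin N → ℝ) (s : Set (Fin N → ℝ)) (hs : Convex ℝ s) :
    ConvexOn ℝ s (fcvx l1 l2 μ r) := by
  have hq : ConvexOn ℝ s (fun w => w ⬝ᵥ (covar r).mulVec w) := by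
    refine ⟨hs, fun x _ y _ p q hp hq hpq => ?_⟩
    simp only [covar, dotProduct_average_vecMulVec_mulVec, smul_eq_mul]
    rw [mul_left_comm p, mul_left_comm q, ← mul_add]
    refine mul_le_mul_of_nonneg_left ?_ (by positivity)
    rw [Finset.mul_sum, Finset.mul_sum, ← Finset.sum_add_distrib]
    refine Finset.sum_le_sum fun t _ => ?_
    simp only [dotProduct_comm (r t), add_dotProduct, smul_dotProduct, smul_eq_mul]
    obtain rfl : q = 1 - p := by linarith
    nlinarith [mul_nonneg (mul_nonneg hp hq) (sq_nonneg (x ⬝ᵥ r t - y ⬝ᵥ r t))]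
  have h := (convexOn_dotProduct ((-l1) • μ) s hs).add (hq.smul hl2)
  refine h.congr fun w _ => ?_
  simp [fcvx, smul_dotProduct]

/-- Quadratic growth at a minimizer of a convex function plus `(τ/2) wᵀw`. -/
theorem quadratic_growth_of_isMin {N : ℕ} {s : Set (Fin N → ℝ)} {f : (Fin N → ℝ) → ℝ}
    (hf : ConvexOn ℝ s f) (τ : ℝ) {x y : Fin N → ℝ} (hx : x ∈ s) (hy : y ∈ s)
    (hmin : ∀ w ∈ s, f x + τ / 2 * (x ⬝ᵥ x) ≤ f w + τ / 2 * (w ⬝ᵥ w)) :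
    f x + τ / 2 * (x ⬝ᵥ x) ≤ f y + τ / 2 * (y ⬝ᵥ y) - τ / 2 * ∑ i, (x i - y i) ^ 2 := by
  have hd : ∑ i, (x i - y i) ^ 2 = x ⬝ᵥ x - 2 * (x ⬝ᵥ y) + y ⬝ᵥ y := by
    simp only [dotProduct, Finset.mul_sum, ← Finset.sum_sub_distrib, ← Finset.sum_add_distrib]
    exact Finset.sum_congr rfl fun i _ => by ring
  have key : ∀ θ ∈ Set.Ioo (0 : ℝ) 1, f x + τ / 2 * (x ⬝ᵥ x)
      ≤ f y + τ / 2 * (y ⬝ᵥ y) - τ / 2 * (1 - θ) * ∑ i, (x i - y i) ^ 2 := by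
    rintro θ ⟨h0, h1⟩
    have h1' : 0 ≤ 1 - θ := by linarith
    have hw := hmin _ (hf.1 hx hy h1' h0.le (by ring))
    have hc := hf.2 hx hy h1' h0.le (by ring)
    simp only [add_dotProduct, dotProduct_add, smul_dotProduct, dotProduct_smul, smul_eq_mul,
      dotProduct_comm y x] at hw hc
    refine le_of_mul_le_mul_left ?_ h0
    rw [hd]
    linarith
  have hlim : Tendsto (fun θ : ℝ => f y + τ / 2 * (y ⬝ᵥ y)
      - τ / 2 * (1 - θ) * ∑ i, (x i - y i) ^ 2) (𝓝[>] 0)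
      (𝓝 (f y + τ / 2 * (y ⬝ᵥ y) - τ / 2 * (1 - 0) * ∑ i, (x i - y i) ^ 2)) :=
    (Continuous.tendsto (by fun_prop) 0).mono_left nhdsWithin_le_nhds
  rw [sub_zero, mul_one] at hlim
  exact ge_of_tendsto hlim (Filter.mem_of_superset (Ioo_mem_nhdsGT one_pos) key)

theorem convex_Feas (N : ℕ) (α : ℝ) : Convex ℝ (Feas N α) := by
  rintro x ⟨hx, hx'⟩ y ⟨hy, hy'⟩ p q hp hq hpq
  refine ⟨?_, fun i => ?_⟩
  · simp [Finset.sum_add_distrib, ← Finset.mul_sum, hx, hy, hpq]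
  · calc |(p • x + q • y) i| ≤ p * |x i| + q * |y i| := by
          refine (abs_add_le _ _).trans_eq ?_
          simp [abs_mul, abs_of_nonneg hp, abs_of_nonneg hq]
      _ ≤ p * α + q * α := by
          gcongr
          exacts [hx' i, hy' i]
      _ = α := by rw [← add_mul, hpq, one_mul]


/-- sufficient-decrease property of one pDCA step. If `wʲ ∈ C`, `sʲ` is a
subgradient of the largest-`k` norm at `wʲ`, and `wʲ⁺¹` minimizes over `C` the pDCA
subproblem objective `G`, then
`f_p(wʲ⁺¹) ≤ f_p(wʲ) − (τ_dc/2) ‖wʲ⁺¹ − wʲ‖²`. -/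
theorem pdca_sufficient_decrease {N T : ℕ} (hN : 0 < N) (hT : 1 ≤ T)
    (l1 l2 l3 l4 α ρ : ℝ) (hl1 : 0 < l1) (hl2 : 0 < l2) (hl3 : 0 < l3) (hl4 : 0 < l4)
    (hα : 0 < α) (hρ : 0 < ρ) (k : ℕ) (hk1 : 1 ≤ k) (hkN : k ≤ N)
    (μ : Fin N → ℝ) (r : Fin T → Fin N → ℝ)
    (wj sj wj1 : Fin N → ℝ)
    (hwj : wj ∈ Feas N α)
    (hsj : IsSubgradTopk k wj sj)
    (hwj1 : wj1 ∈ Feas N α)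
    (hmin : ∀ w ∈ Feas N α,
      Gpdca l1 l2 l3 l4 α ρ μ r wj sj wj1 ≤ Gpdca l1 l2 l3 l4 α ρ μ r wj sj w) :
    fpen l1 l2 l3 l4 ρ k μ r wj1
      ≤ fpen l1 l2 l3 l4 ρ k μ r wj - tauDC α l3 l4 r / 2 * ∑ i, (wj1 i - wj i) ^ 2 := by
  set c := tauDC α l3 l4 r • wj - gradfncvx l3 l4 r wj + ρ • sj with hc
  have hC := convex_Feas N α
  have hconv : ConvexOn ℝ (Feas N α)
      (fun w => fcvx l1 l2 μ r w + ρ * ell1 w + (-c) ⬝ᵥ w) :=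
    ((convexOn_fcvx l1 l2 hl2.le μ r _ hC).add ((convexOn_ell1 _ hC).smul hρ.le)).add
      (convexOn_dotProduct (-c) _ hC)
  have hgrow := quadratic_growth_of_isMin hconv (tauDC α l3 l4 r) hwj1 hwj fun w hw => by
    have := hmin w hw
    simp only [Gpdca, ← hc] at this
    simp only [neg_dotProduct]
    linarith
  have hdesc := fncvx_descent l3 l4 α hl3.le hl4.le hα.le r wj wj1 hwj.2 hwj1.2
  have hsub := mul_le_mul_of_nonneg_left (hsj wj1) hρ.le
  have hd : ∑ i, (wj1 i - wj i) ^ 2 = wj1 ⬝ᵥ wj1 - 2 * (wj ⬝ᵥ wj1) + wj ⬝ᵥ wj := by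
    simp only [dotProduct, Finset.mul_sum, ← Finset.sum_sub_distrib, ← Finset.sum_add_distrib]
    exact Finset.sum_congr rfl fun i _ => by ring
  simp only [hc, neg_dotProduct, add_dotProduct, sub_dotProduct, smul_dotProduct, dotProduct_sub,
    smul_eq_mul, hd] at hgrow hdesc hsub ⊢
  unfold fpen ftot
  linarith
end

section
/- Let X ∈ ℝ^{N×N} be a real symmetric matrix with eigendecomposition X = U Diag(d) Uᵀ, where U is orthogonal and d ∈ ℝ^N is the vector of eigenvalues. Then the matrix X₊ = U Diag(d₊) Uᵀ, where (d₊)_i = max(d_i, 0), is the nearest symmetric positive semidefinite matrix to X in the Frobenius norm: X₊ is symmetric positive semidefinite and for every symmetric positive semidefinite matrix Y ∈ ℝ^{N×N}, ‖X − X₊‖_F ≤ ‖X − Y‖_F. -/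
open Matrix Finset Filter Topology

/-- The sum of the squared entries of a real matrix is the trace of `Aᵀ * A`. -/
theorem sum_sq_eq_trace_transpose_mul {m n : Type*} [Fintype m] [Fintype n]
    (A : Matrix m n ℝ) : ∑ i, ∑ j, A i j ^ 2 = (Aᵀ * A).trace := by
  rw [Finset.sum_comm]
  simp [Matrix.trace, Matrix.mul_apply, sq]

/-- The sum of the squared entries is invariant under orthogonal conjugation. -/
theorem sum_sq_orthogonal_conj {n : Type*} [Fintype n] [DecidableEq n] {U : Matrix n n ℝ}
    (hU : Uᵀ * U = 1) (A : Matrix n n ℝ) :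
    ∑ i, ∑ j, (U * A * Uᵀ) i j ^ 2 = ∑ i, ∑ j, A i j ^ 2 := by
  simp only [sum_sq_eq_trace_transpose_mul]
  calc ((U * A * Uᵀ)ᵀ * (U * A * Uᵀ)).trace = (U * (Aᵀ * (Uᵀ * U) * A * Uᵀ)).trace := by
        simp only [Matrix.transpose_mul, Matrix.transpose_transpose, Matrix.mul_assoc]
    _ = (Aᵀ * A).trace := by
        rw [Matrix.trace_mul_comm, hU, Matrix.mul_one, Matrix.mul_assoc, hU, Matrix.mul_one]

/-- Among matrices with nonnegative diagonal, `diagonal d⁺` minimizes the sum of the squared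
entries of the difference with `diagonal d`. -/
theorem sum_sq_diagonal_sub_posPart_le {n : Type*} [Fintype n] [DecidableEq n] (d : n → ℝ)
    (Z : Matrix n n ℝ) (hZ : ∀ i, 0 ≤ Z i i) :
    ∑ i, ∑ j, (diagonal d - diagonal fun i => max (d i) 0) i j ^ 2 ≤
      ∑ i, ∑ j, (diagonal d - Z) i j ^ 2 := by
  refine Finset.sum_le_sum fun i _ => Finset.sum_le_sum fun j _ => ?_
  obtain rfl | hij := eq_or_ne i j
  · simp only [Matrix.sub_apply, Matrix.diagonal_apply_eq]
    rcases le_total (d i) 0 with h | h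
    · rw [max_eq_right h]
      nlinarith [hZ i, mul_nonneg (neg_nonneg.mpr h) (hZ i)]
    · rw [max_eq_left h, sub_self, zero_pow two_ne_zero]
      positivity
  · simp only [Matrix.sub_apply, Matrix.diagonal_apply_ne _ hij, sub_self, zero_pow two_ne_zero]
    positivity

/-- Higham: for a real symmetric `X = U Diag(d) Uᵀ` with `U` orthogonal,
the matrix `X₊ = U Diag(d₊) Uᵀ` (with negative eigenvalues replaced by `0`) is the nearest
symmetric positive semidefinite matrix to `X` in the Frobenius norm. -/
theorem nearest_psd_matrix {N : ℕ} (X U : Matrix (Fin N) (Fin N) ℝ) (d : Fin N → ℝ)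
    (hX : X.IsSymm) (hU : U ∈ Matrix.orthogonalGroup (Fin N) ℝ)
    (hdecomp : X = U * Matrix.diagonal d * Uᵀ) :
    (U * Matrix.diagonal (fun i => max (d i) 0) * Uᵀ).PosSemidef ∧
      ∀ Y : Matrix (Fin N) (Fin N) ℝ, Y.PosSemidef →
        Real.sqrt (∑ i, ∑ j, (X - U * Matrix.diagonal (fun i => max (d i) 0) * Uᵀ) i j ^ 2)
          ≤ Real.sqrt (∑ i, ∑ j, (X - Y) i j ^ 2) := by
  have hUl : Uᵀ * U = 1 := (Matrix.mem_orthogonalGroup_iff' (Fin N) ℝ).mp hU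
  have hUr : U * Uᵀ = 1 := (Matrix.mem_orthogonalGroup_iff (Fin N) ℝ).mp hU
  refine ⟨?_, fun Y hY => Real.sqrt_le_sqrt ?_⟩
  · simpa using (Matrix.PosSemidef.diagonal (R := ℝ)
      (fun i => le_max_right (d i) 0)).mul_mul_conjTranspose_same U
  · have hZ : (Uᵀ * Y * U).PosSemidef := by simpa using hY.conjTranspose_mul_mul_same U
    have hYU : U * (Uᵀ * Y * U) * Uᵀ = Y := by
      rw [← Matrix.mul_assoc, ← Matrix.mul_assoc, hUr, Matrix.one_mul, Matrix.mul_assoc, hUr,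
        Matrix.mul_one]
    have hXY : X - Y = U * (diagonal d - Uᵀ * Y * U) * Uᵀ := by
      rw [Matrix.mul_sub, Matrix.sub_mul, hYU, hdecomp]
    rw [hXY, hdecomp, ← Matrix.sub_mul, ← Matrix.mul_sub, sum_sq_orthogonal_conj hUl,
      sum_sq_orthogonal_conj hUl]
    exact sum_sq_diagonal_sub_posPart_le d _ fun i => hZ.diag_nonneg
end

section
/- Fix w^j ∈ C, a subgradient s^j of the largest-k norm at w^j, a symmetric positive semidefinite matrix H ∈ ℝ^{N×N}, and τ_w > 0. Let ŵ minimize over C the SCA subproblem objective F_j(w) = f_cvx(w) + ρ‖w‖₁ + f_ncvx(w^j) + ∇f_ncvx(w^j)ᵀ(w − w^j) + (1/2)(w − w^j)ᵀ H (w − w^j) + (τ_w/2)‖w − w^j‖² − ρ (s^j)ᵀ w, and set d = ŵ − w^j. Then dᵀ(∇f(w^j) − ρ s^j) + ρ(‖ŵ‖₁ − ‖w^j‖₁) ≤ −τ_w ‖d‖²; in particular, if ŵ ≠ w^j then d is a strict descent direction for the penalized objective at w^j. -/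
open Matrix Finset Filter Topology

/-- The SCA subproblem objective
`F(w) = f_cvx(w) + ρ‖w‖₁ + f_ncvx(wʲ) + ∇f_ncvx(wʲ)ᵀ(w−wʲ) + ½(w−wʲ)ᵀH(w−wʲ)
        + (τ_w/2)‖w−wʲ‖² − ρ (sʲ)ᵀ w`. -/
noncomputable def Fsca {N T : ℕ} (l1 l2 l3 l4 ρ τw : ℝ) (μ : Fin N → ℝ) (r : Fin T → Fin N → ℝ)
    (wj sj : Fin N → ℝ) (H : Matrix (Fin N) (Fin N) ℝ) (w : Fin N → ℝ) : ℝ :=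
  fcvx l1 l2 μ r w + ρ * ell1 w + fncvx l3 l4 r wj + gradfncvx l3 l4 r wj ⬝ᵥ (w - wj)
    + 1 / 2 * ((w - wj) ⬝ᵥ H.mulVec (w - wj)) + τw / 2 * ∑ i, (w i - wj i) ^ 2
    - ρ * (sj ⬝ᵥ w)

theorem covar_posSemidef {N T : ℕ} (r : Fin T → Fin N → ℝ) : (covar r).PosSemidef := by
  refine Matrix.PosSemidef.smul (Matrix.posSemidef_sum _ fun t _ => ?_) (by positivity)
  simpa using Matrix.posSemidef_vecMulVec_self_star (r t)

theorem Matrix.PosSemidef.real_quadForm_nonneg {N : ℕ} {A : Matrix (Fin N) (Fin N) ℝ}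
    (hA : A.PosSemidef) (x : Fin N → ℝ) : 0 ≤ x ⬝ᵥ A.mulVec x := by
  simpa using hA.dotProduct_mulVec_nonneg x

theorem Matrix.PosSemidef.real_bilin_comm {N : ℕ} {A : Matrix (Fin N) (Fin N) ℝ}
    (hA : A.PosSemidef) (x y : Fin N → ℝ) : x ⬝ᵥ A.mulVec y = y ⬝ᵥ A.mulVec x := by
  have hT : Aᵀ = A := by simpa using hA.isHermitian.eq
  rw [Matrix.dotProduct_mulVec, ← Matrix.mulVec_transpose, hT, dotProduct_comm]

theorem ell1_segment_le {N : ℕ} (w d : Fin N → ℝ) {t : ℝ} (h0 : 0 ≤ t) (h1 : t ≤ 1) :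
    ell1 (w + t • d) - ell1 w ≤ t * (ell1 (w + d) - ell1 w) := by
  unfold ell1
  rw [← Finset.sum_sub_distrib, ← Finset.sum_sub_distrib, Finset.mul_sum]
  refine Finset.sum_le_sum fun i _ => ?_
  have h := abs_add_le ((1 - t) * w i) (t * (w i + d i))
  rw [abs_mul, abs_mul, abs_of_nonneg h0, abs_of_nonneg (sub_nonneg.2 h1),
    show (1 - t) * w i + t * (w i + d i) = w i + t * d i by ring] at h
  simp only [Pi.add_apply, Pi.smul_apply, smul_eq_mul]
  linarith

/-- Expansion of the SCA subproblem objective along the line through `wj` with direction `d`. -/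
theorem Fsca_line {N T : ℕ} (l1 l2 l3 l4 ρ τw : ℝ) (μ : Fin N → ℝ) (r : Fin T → Fin N → ℝ)
    (wj sj d : Fin N → ℝ) (H : Matrix (Fin N) (Fin N) ℝ) (t : ℝ) :
    Fsca l1 l2 l3 l4 ρ τw μ r wj sj H (wj + t • d) =
      fcvx l1 l2 μ r wj + fncvx l3 l4 r wj - ρ * (sj ⬝ᵥ wj) + ρ * ell1 (wj + t • d)
        + t * (d ⬝ᵥ (gradf l1 l2 l3 l4 μ r wj - ρ • sj))
        + t ^ 2 * (l2 * (d ⬝ᵥ (covar r).mulVec d) + 1 / 2 * (d ⬝ᵥ H.mulVec d)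
          + τw / 2 * ∑ i, d i ^ 2) := by
  have hsq : ∑ i, ((wj + t • d) i - wj i) ^ 2 = t ^ 2 * ∑ i, d i ^ 2 := by
    simp [mul_pow, Finset.mul_sum]
  unfold Fsca
  rw [hsq, add_sub_cancel_left]
  simp only [fcvx, gradf, Matrix.mulVec_add, Matrix.mulVec_smul, dotProduct_add, add_dotProduct,
    dotProduct_smul, smul_dotProduct, dotProduct_sub, smul_eq_mul,
    (covar_posSemidef r).real_bilin_comm wj d, dotProduct_comm d μ, dotProduct_comm d sj,
    dotProduct_comm d (gradfncvx l3 l4 r wj)]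
  ring

/-- If `X + b ≤ t X + t² b` on `[0, 1)`, then dividing by `1 - t` and letting `t → 1` gives
`X ≤ -2 b`. -/
theorem le_neg_two_mul_of_forall_segment {X b : ℝ}
    (h : ∀ t : ℝ, 0 ≤ t → t < 1 → X + b ≤ t * X + t ^ 2 * b) : X ≤ -(2 * b) := by
  have hlt : ∀ t ∈ Set.Ico (0 : ℝ) 1, X ≤ -((1 + t) * b) := by
    rintro t ⟨h0, h1⟩
    have := h t h0 h1
    refine le_of_mul_le_mul_left ?_ (sub_pos.2 h1)
    linarith
  have hcont : Continuous fun t : ℝ => -((1 + t) * b) := by fun_prop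
  have hcl : (1 : ℝ) ∈ closure (Set.Ico (0 : ℝ) 1) := by
    rw [closure_Ico zero_ne_one]
    simp
  have : X ≤ -((1 + 1) * b) := closure_minimal hlt (isClosed_le continuous_const hcont) hcl
  linarith

/-- the SCA search direction is a descent direction. If `ŵ` minimizes the
SCA subproblem objective over `C` and `d = ŵ − wʲ`, then
`dᵀ(∇f(wʲ) − ρ sʲ) + ρ(‖ŵ‖₁ − ‖wʲ‖₁) ≤ −τ_w ‖d‖²`; in particular, if `ŵ ≠ wʲ` then `d`
is a strict descent direction for the penalized objective at `wʲ`. -/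
theorem sca_descent_direction {N T : ℕ} (hN : 0 < N) (hT : 1 ≤ T)
    (l1 l2 l3 l4 α ρ τw : ℝ) (hl1 : 0 < l1) (hl2 : 0 < l2) (hl3 : 0 < l3) (hl4 : 0 < l4)
    (hα : 0 < α) (hρ : 0 < ρ) (hτw : 0 < τw) (k : ℕ) (hk1 : 1 ≤ k) (hkN : k ≤ N)
    (μ : Fin N → ℝ) (r : Fin T → Fin N → ℝ)
    (wj sj what : Fin N → ℝ) (H : Matrix (Fin N) (Fin N) ℝ)
    (hwj : wj ∈ Feas N α)
    (hsj : IsSubgradTopk k wj sj)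
    (hH : H.PosSemidef)
    (hwhat : what ∈ Feas N α)
    (hmin : ∀ v ∈ Feas N α,
      Fsca l1 l2 l3 l4 ρ τw μ r wj sj H what ≤ Fsca l1 l2 l3 l4 ρ τw μ r wj sj H v)
    (d : Fin N → ℝ) (hd : d = what - wj) :
    d ⬝ᵥ (gradf l1 l2 l3 l4 μ r wj - ρ • sj) + ρ * (ell1 what - ell1 wj)
        ≤ -τw * ∑ i, d i ^ 2 ∧
      (what ≠ wj →
        d ⬝ᵥ (gradf l1 l2 l3 l4 μ r wj - ρ • sj) + ρ * (ell1 what - ell1 wj) < 0) := by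
  have hseg : ∀ t : ℝ, 0 ≤ t → t < 1 → wj + t • d ∈ Feas N α := fun t h0 h1 => by
    rw [hd]
    exact (convex_Feas N α).add_smul_sub_mem hwj hwhat ⟨h0, h1.le⟩
  have hwd : what = wj + d := by simp [hd]
  have hmain := le_neg_two_mul_of_forall_segment
    (X := d ⬝ᵥ (gradf l1 l2 l3 l4 μ r wj - ρ • sj) + ρ * (ell1 what - ell1 wj))
    (b := l2 * (d ⬝ᵥ (covar r).mulVec d) + 1 / 2 * (d ⬝ᵥ H.mulVec d) + τw / 2 * ∑ i, d i ^ 2)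
    fun t h0 h1 => by
      have hle := hmin _ (hseg t h0 h1)
      have hF := Fsca_line l1 l2 l3 l4 ρ τw μ r wj sj d H 1
      rw [one_smul, ← hwd] at hF
      rw [hF, Fsca_line] at hle
      have hell := mul_le_mul_of_nonneg_left (ell1_segment_le wj d h0 h1.le) hρ.le
      rw [← hwd] at hell
      linarith
  have hcov := mul_nonneg hl2.le ((covar_posSemidef r).real_quadForm_nonneg d)
  have hHd := hH.real_quadForm_nonneg d
  have hbound : d ⬝ᵥ (gradf l1 l2 l3 l4 μ r wj - ρ • sj) + ρ * (ell1 what - ell1 wj)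
      ≤ -τw * ∑ i, d i ^ 2 := by linarith
  refine ⟨hbound, fun hne => hbound.trans_lt ?_⟩
  obtain ⟨i, hi⟩ := Function.ne_iff.1 hne
  have hdi : d i ≠ 0 := by simpa [hd, sub_eq_zero] using hi
  have hpos : 0 < ∑ i, d i ^ 2 :=
    Finset.sum_pos' (fun j _ => sq_nonneg (d j)) ⟨i, Finset.mem_univ i, by positivity⟩
  rw [neg_mul]
  exact neg_neg_of_pos (mul_pos hτw hpos)
end

section
/- Fix w^j ∈ C, a subgradient s^j of the largest-k norm at w^j, ŵ ∈ C, c ∈ (0, 1), and set d = ŵ − w^j and Δ_j = dᵀ(∇f(w^j) − ρ s^j) + ρ(‖ŵ‖₁ − ‖w^j‖₁). If γ ∈ (0, 1] satisfies the Armijo condition f(w^j + γ d) − γ ρ dᵀ s^j + γ ρ (‖ŵ‖₁ − ‖w^j‖₁) ≤ f(w^j) + c γ Δ_j, then f_p(w^j + γ d) ≤ f_p(w^j) + c γ Δ_j; in particular, if Δ_j < 0 then f_p(w^j + γ d) < f_p(w^j). -/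
open Matrix Finset Filter Topology

/-- The ℓ₁ norm is convex along segments. -/
theorem ell1_add_smul_sub_le {N : ℕ} (u v : Fin N → ℝ) {γ : ℝ} (hγ0 : 0 ≤ γ) (hγ1 : γ ≤ 1) :
    ell1 (u + γ • (v - u)) ≤ ell1 u + γ * (ell1 v - ell1 u) := by
  unfold ell1
  rw [← Finset.sum_sub_distrib, Finset.mul_sum, ← Finset.sum_add_distrib]
  refine Finset.sum_le_sum fun i _ => ?_
  calc |(u + γ • (v - u)) i| = |(1 - γ) * u i + γ * v i| := by
        congr 1
        simp only [Pi.add_apply, Pi.smul_apply, Pi.sub_apply, smul_eq_mul]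
        ring
    _ ≤ |(1 - γ) * u i| + |γ * v i| := abs_add_le _ _
    _ = |u i| + γ * (|v i| - |u i|) := by
        rw [abs_mul, abs_mul, abs_of_nonneg hγ0, abs_of_nonneg (sub_nonneg.2 hγ1)]
        ring

/-- if the stepsize `γ ∈ (0,1]` satisfies the Armijo condition
`f(wʲ + γd) − γρ dᵀsʲ + γρ(‖ŵ‖₁ − ‖wʲ‖₁) ≤ f(wʲ) + cγΔⱼ`, then the penalized objective
satisfies `f_p(wʲ + γd) ≤ f_p(wʲ) + cγΔⱼ`; in particular if `Δⱼ < 0` then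
`f_p(wʲ + γd) < f_p(wʲ)`. -/
theorem armijo_gives_fp_decrease {N T : ℕ} (hN : 0 < N) (hT : 1 ≤ T)
    (l1 l2 l3 l4 α ρ c : ℝ) (hl1 : 0 < l1) (hl2 : 0 < l2) (hl3 : 0 < l3) (hl4 : 0 < l4)
    (hα : 0 < α) (hρ : 0 < ρ) (hc : 0 < c ∧ c < 1) (k : ℕ) (hk1 : 1 ≤ k) (hkN : k ≤ N)
    (μ : Fin N → ℝ) (r : Fin T → Fin N → ℝ)
    (wj sj what : Fin N → ℝ)
    (hwj : wj ∈ Feas N α)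
    (hsj : IsSubgradTopk k wj sj)
    (hwhat : what ∈ Feas N α)
    (d : Fin N → ℝ) (hd : d = what - wj)
    (Δ : ℝ)
    (hΔ : Δ = d ⬝ᵥ (gradf l1 l2 l3 l4 μ r wj - ρ • sj) + ρ * (ell1 what - ell1 wj))
    (γ : ℝ) (hγ0 : 0 < γ) (hγ1 : γ ≤ 1)
    (harmijo : ftot l1 l2 l3 l4 μ r (wj + γ • d) - γ * ρ * (d ⬝ᵥ sj)
        + γ * ρ * (ell1 what - ell1 wj) ≤ ftot l1 l2 l3 l4 μ r wj + c * γ * Δ) :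
    fpen l1 l2 l3 l4 ρ k μ r (wj + γ • d) ≤ fpen l1 l2 l3 l4 ρ k μ r wj + c * γ * Δ ∧
      (Δ < 0 → fpen l1 l2 l3 l4 ρ k μ r (wj + γ • d) < fpen l1 l2 l3 l4 ρ k μ r wj) := by
  have hell := ell1_add_smul_sub_le wj what hγ0.le hγ1
  rw [← hd] at hell
  have htop := hsj (wj + γ • d)
  rw [add_sub_cancel_left, dotProduct_smul, smul_eq_mul, dotProduct_comm] at htop
  have hdecrease : fpen l1 l2 l3 l4 ρ k μ r (wj + γ • d) ≤
      fpen l1 l2 l3 l4 ρ k μ r wj + c * γ * Δ := by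
    unfold fpen
    linarith [mul_le_mul_of_nonneg_left hell hρ.le, mul_le_mul_of_nonneg_left htop hρ.le]
  refine ⟨hdecrease, fun hΔneg => hdecrease.trans_lt ?_⟩
  linarith [mul_neg_of_pos_of_neg (mul_pos hc.1 hγ0) hΔneg]
end
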